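/- arXiv:1502.04731 — 4 statements merged into one kernel-verified Lean document; each statement's English description precedes it below -/
import Mathlib

section
/- For every continuously differentiable function φ : ℝ → ℝ with φ'(y) > 0 for all y ∈ [0,1] and φ(0) + φ(1) = 1, and every z₁ > 0, set z₀ := z₁ + 1, u_φ(x,y) := φ(y), σ_φ(x,y) := 1/φ'(y), U₀ := φ(0) − z₀ and U₁ := φ(1) + z₁. Then: (a) σ_φ(x,y)·∇u_φ(x,y) = (0,1) for all (x,y) in the closed unit square, so that σ_φ|∇u_φ| ≡ 1 and div(σ_φ∇u_φ) = 0; (b) u_φ(x,0) − z₀σ_φ(x,0)∂_y u_φ(x,0) = U₀ and u_φ(x,1) + z₁σ_φ(x,1)∂_y u_φ(x,1) = U₁ for all x ∈ [0,1]; (c) ∫₀¹ −σ_φ(x,0)∂_y u_φ(x,0) dx = −1 and ∫₀¹ σ_φ(x,1)∂_y u_φ(x,1) dx = 1; (d) ∂_x u_φ(0,y) = ∂_x u_φ(1,y) = 0 for all y ∈ [0,1]; (e) U₀ + U₁ = 0. In particular, all these pairs (u_φ, (U₀,U₁)) are classical CEM solutions on the unit square for the conductivities σ_φ with the same electrode data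 (z₀, z₁, I₀ = −1, I₁ = 1) and the same interior current magnitude |σ_φ∇u_φ| ≡ 1, even though σ_φ varies with φ. -/
open MeasureTheory Set

/-- Partial derivative in the first (x) variable. -/
noncomputable def pdx (u : ℝ × ℝ → ℝ) (p : ℝ × ℝ) : ℝ :=
  deriv (fun t => u (t, p.2)) p.1

/-- Partial derivative in the second (y) variable. -/
noncomputable def pdy (u : ℝ × ℝ → ℝ) (p : ℝ × ℝ) : ℝ :=
  deriv (fun t => u (p.1, t)) p.2

/-- Euclidean norm of the gradient `|∇u|`. -/
noncomputable def gradNorm (u : ℝ × ℝ → ℝ) (p : ℝ × ℝ) : ℝ :=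
  Real.sqrt ((pdx u p) ^ 2 + (pdy u p) ^ 2)

/-- The closed unit square `[0,1] × [0,1]`. -/
def SQ : Set (ℝ × ℝ) := Icc (0 : ℝ) 1 ×ˢ Icc (0 : ℝ) 1

/-- The open unit square `(0,1) × (0,1)`. -/
def SQo : Set (ℝ × ℝ) := Ioo (0 : ℝ) 1 ×ˢ Ioo (0 : ℝ) 1

/-- `v` is continuously differentiable on an open neighborhood of the closed unit square. -/
def C1Nbhd (v : ℝ × ℝ → ℝ) : Prop :=
  ∃ W : Set (ℝ × ℝ), IsOpen W ∧ SQ ⊆ W ∧ ContDiffOn ℝ 1 v W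

/-- A classical solution `(u, (U₀, U₁))` of the Complete Electrode Model on the unit square
for the conductivity `σ`, constant impedances `z₀, z₁` (bottom/top electrodes) and
input currents `I₀, I₁`. -/
structure IsCEMSolution (σ u : ℝ × ℝ → ℝ) (U₀ U₁ z₀ z₁ I₀ I₁ : ℝ) : Prop where
  smooth : ∃ W : Set (ℝ × ℝ), IsOpen W ∧ SQ ⊆ W ∧ ContDiffOn ℝ 2 u W
  ground : U₀ + U₁ = 0
  pde : ∀ p ∈ SQo,
    pdx (fun q => σ q * pdx u q) p + pdy (fun q => σ q * pdy u q) p = 0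
  robin_bot : ∀ x ∈ Icc (0 : ℝ) 1, u (x, 0) - z₀ * σ (x, 0) * pdy u (x, 0) = U₀
  robin_top : ∀ x ∈ Icc (0 : ℝ) 1, u (x, 1) + z₁ * σ (x, 1) * pdy u (x, 1) = U₁
  flux_bot : (∫ x in (0 : ℝ)..1, -(σ (x, 0) * pdy u (x, 0))) = I₀
  flux_top : (∫ x in (0 : ℝ)..1, σ (x, 1) * pdy u (x, 1)) = I₁
  noflux_left : ∀ y ∈ Icc (0 : ℝ) 1, pdx u (0, y) = 0
  noflux_right : ∀ y ∈ Icc (0 : ℝ) 1, pdx u (1, y) = 0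

/-- The weighted least-gradient functional `G_a` with CEM boundary terms. -/
noncomputable def Gfun (a : ℝ × ℝ → ℝ) (z₀ z₁ I₀ I₁ : ℝ) (v : ℝ × ℝ → ℝ)
    (V₀ V₁ : ℝ) : ℝ :=
  (∫ p in SQo, a p * gradNorm v p)
    + (1 / (2 * z₀)) * (∫ x in (0 : ℝ)..1, (v (x, 0) - V₀) ^ 2)
    + (1 / (2 * z₁)) * (∫ x in (0 : ℝ)..1, (v (x, 1) - V₁) ^ 2)
    - I₀ * V₀ - I₁ * V₁

/-- The CEM energy functional `F_σ`. -/
noncomputable def Ffun (σ : ℝ × ℝ → ℝ) (z₀ z₁ I₀ I₁ : ℝ) (v : ℝ × ℝ → ℝ)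
    (V₀ V₁ : ℝ) : ℝ :=
  (1 / 2) * (∫ p in SQo, σ p * ((pdx v p) ^ 2 + (pdy v p) ^ 2))
    + (1 / (2 * z₀)) * (∫ x in (0 : ℝ)..1, (v (x, 0) - V₀) ^ 2)
    + (1 / (2 * z₁)) * (∫ x in (0 : ℝ)..1, (v (x, 1) - V₁) ^ 2)
    - I₀ * V₀ - I₁ * V₁

@[simp]
theorem pdx_comp_snd (f : ℝ → ℝ) (p : ℝ × ℝ) : pdx (fun q => f q.2) p = 0 := by
  simp [pdx]

@[simp]
theorem pdy_comp_snd (f : ℝ → ℝ) (p : ℝ × ℝ) : pdy (fun q => f q.2) p = deriv f p.2 := rfl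

/-- A vertical field that depends only on `y` and is constant on `(0,1)` has zero divergence. -/
theorem pdy_comp_snd_eq_zero_of_eq_const {f : ℝ → ℝ} {c : ℝ} (hf : ∀ y ∈ Ioo (0 : ℝ) 1, f y = c)
    {p : ℝ × ℝ} (hp : p ∈ SQo) : pdy (fun q => f q.2) p = 0 := by
  have h : f =ᶠ[nhds p.2] fun _ => c := by
    filter_upwards [isOpen_Ioo.mem_nhds hp.2] with y hy using hf y hy
  rw [pdy_comp_snd, h.deriv_eq, deriv_const]

/-- Non-uniqueness example on the unit square: for every increasing `C¹` function `φ` with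
`φ 0 + φ 1 = 1`, the pair `(u_φ, (U₀, U₁))` with `u_φ(x,y) = φ(y)`, `σ_φ(x,y) = 1/φ'(y)`,
`U₀ = φ 0 - z₀`, `U₁ = φ 1 + z₁`, `z₀ = z₁ + 1`, satisfies all the CEM equations with
currents `I₀ = -1`, `I₁ = 1` and interior current magnitude `σ_φ |∇u_φ| ≡ 1`. -/
theorem nonuniqueness_example_unit_square (φ : ℝ → ℝ) (hφ : ContDiff ℝ 1 φ)
    (hφ' : ∀ y ∈ Icc (0 : ℝ) 1, 0 < deriv φ y) (hφsum : φ 0 + φ 1 = 1)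
    (z₁ : ℝ) (hz₁ : 0 < z₁) :
    let z₀ : ℝ := z₁ + 1
    let uφ : ℝ × ℝ → ℝ := fun p => φ p.2
    let σφ : ℝ × ℝ → ℝ := fun p => 1 / deriv φ p.2
    let U₀ : ℝ := φ 0 - z₀
    let U₁ : ℝ := φ 1 + z₁
    -- (a) σ_φ ∇u_φ = (0,1), so σ_φ|∇u_φ| ≡ 1 and div(σ_φ∇u_φ) = 0
    (∀ p ∈ SQ, σφ p * pdx uφ p = 0 ∧ σφ p * pdy uφ p = 1) ∧
    (∀ p ∈ SQ, σφ p * gradNorm uφ p = 1) ∧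
    (∀ p ∈ SQo,
      pdx (fun q => σφ q * pdx uφ q) p + pdy (fun q => σφ q * pdy uφ q) p = 0) ∧
    -- (b) Robin boundary conditions on the electrodes
    (∀ x ∈ Icc (0 : ℝ) 1, uφ (x, 0) - z₀ * σφ (x, 0) * pdy uφ (x, 0) = U₀) ∧
    (∀ x ∈ Icc (0 : ℝ) 1, uφ (x, 1) + z₁ * σφ (x, 1) * pdy uφ (x, 1) = U₁) ∧
    -- (c) flux conditions: I₀ = -1, I₁ = 1
    ((∫ x in (0 : ℝ)..1, -(σφ (x, 0) * pdy uφ (x, 0))) = -1) ∧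
    ((∫ x in (0 : ℝ)..1, σφ (x, 1) * pdy uφ (x, 1)) = 1) ∧
    -- (d) no flux through the lateral edges
    (∀ y ∈ Icc (0 : ℝ) 1, pdx uφ (0, y) = 0 ∧ pdx uφ (1, y) = 0) ∧
    -- (e) normalization of electrode voltages
    U₀ + U₁ = 0 := by
  intro z₀ uφ σφ U₀ U₁
  have hx (p : ℝ × ℝ) : pdx uφ p = 0 := pdx_comp_snd φ p
  have hy (p : ℝ × ℝ) : pdy uφ p = deriv φ p.2 := pdy_comp_snd φ p
  have hinv (y : ℝ) (h : y ∈ Icc (0 : ℝ) 1) : 1 / deriv φ y * deriv φ y = 1 :=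
    one_div_mul_cancel (hφ' y h).ne'
  have hflux (p : ℝ × ℝ) (h : p.2 ∈ Icc (0 : ℝ) 1) : σφ p * pdy uφ p = 1 := by
    rw [hy]
    exact hinv p.2 h
  have hbot (x : ℝ) : σφ (x, 0) * pdy uφ (x, 0) = 1 := hflux _ (by simp)
  have htop (x : ℝ) : σφ (x, 1) * pdy uφ (x, 1) = 1 := hflux _ (by simp)
  refine ⟨fun p hp => ⟨by rw [hx, mul_zero], hflux p hp.2⟩, fun p hp => ?_, fun p hp => ?_,
    fun x _ => ?_, fun x _ => ?_, by simp [hbot], by simp [htop],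
    fun y _ => ⟨hx _, hx _⟩, ?_⟩
  · have hgrad : gradNorm uφ p = pdy uφ p := by
      rw [gradNorm, hx, zero_pow two_ne_zero, zero_add, hy, Real.sqrt_sq (hφ' p.2 hp.2).le]
    rw [hgrad, hflux p hp.2]
  · have h₁ : pdx (fun q => σφ q * pdx uφ q) p = 0 := by
      simp only [hx, mul_zero]
      exact pdx_comp_snd (fun _ => 0) p
    have h₂ : pdy (fun q => σφ q * pdy uφ q) p = 0 :=
      pdy_comp_snd_eq_zero_of_eq_const (f := fun y => 1 / deriv φ y * deriv φ y)
        (fun y h => hinv y (Ioo_subset_Icc_self h)) hp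
    rw [h₁, h₂, add_zero]
  · rw [mul_assoc, hbot, mul_one]
  · rw [mul_assoc, htop, mul_one]
  · simp only [U₀, U₁, z₀]
    linarith
end

section
/- Let σ be continuously differentiable and positive on an open neighborhood of the closed unit square, let I₀ + I₁ = 0, and let (u, U) be a classical CEM solution for σ with impedances z₀, z₁ > 0 and currents I₀, I₁. Set a := σ|∇u| on the closed square. Then for every v continuously differentiable on an open neighborhood of the closed square and every V = (V₀,V₁) ∈ ℝ² with V₀ + V₁ = 0, one has G_a(v,V) ≥ G_a(u,U); that is, (u,U) is a global minimizer of the weighted least-gradient functional G_a over such pairs (v,V). -/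
open MeasureTheory Set

lemma pdx_eq_fderiv {f : ℝ × ℝ → ℝ} {p : ℝ × ℝ} (hf : DifferentiableAt ℝ f p) :
    pdx f p = fderiv ℝ f p (1, 0) :=
  HasDerivAt.deriv <| hf.hasFDerivAt.comp_hasDerivAt (f := fun t : ℝ => (t, p.2)) p.1
    ((hasDerivAt_id p.1).prodMk (hasDerivAt_const p.1 p.2))

lemma pdy_eq_fderiv {f : ℝ × ℝ → ℝ} {p : ℝ × ℝ} (hf : DifferentiableAt ℝ f p) :
    pdy f p = fderiv ℝ f p (0, 1) :=
  HasDerivAt.deriv <| hf.hasFDerivAt.comp_hasDerivAt (f := fun t : ℝ => (p.1, t)) p.2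
    ((hasDerivAt_const p.2 p.1).prodMk (hasDerivAt_id p.2))

lemma ContDiffOn.pdx {m n : WithTop ℕ∞} {f : ℝ × ℝ → ℝ} {W : Set (ℝ × ℝ)}
    (hf : ContDiffOn ℝ n f W) (hW : IsOpen W) (hmn : m + 1 ≤ n) : ContDiffOn ℝ m (pdx f) W := by
  have hn : n ≠ 0 := fun h => by simp [h] at hmn
  refine ((hf.fderiv_of_isOpen hW hmn).clm_apply (contDiffOn_const (c := (1, 0)))).congr
    fun p hp => ?_
  exact pdx_eq_fderiv ((hf.differentiableOn hn).differentiableAt (hW.mem_nhds hp))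

lemma ContDiffOn.pdy {m n : WithTop ℕ∞} {f : ℝ × ℝ → ℝ} {W : Set (ℝ × ℝ)}
    (hf : ContDiffOn ℝ n f W) (hW : IsOpen W) (hmn : m + 1 ≤ n) : ContDiffOn ℝ m (pdy f) W := by
  have hn : n ≠ 0 := fun h => by simp [h] at hmn
  refine ((hf.fderiv_of_isOpen hW hmn).clm_apply (contDiffOn_const (c := (0, 1)))).congr
    fun p hp => ?_
  exact pdy_eq_fderiv ((hf.differentiableOn hn).differentiableAt (hW.mem_nhds hp))

lemma continuousOn_gradNorm {f : ℝ × ℝ → ℝ} {W : Set (ℝ × ℝ)} (hf : ContDiffOn ℝ 1 f W)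
    (hW : IsOpen W) : ContinuousOn (gradNorm f) W :=
  (((hf.pdx (m := 0) hW (by simp)).continuousOn.pow 2).add
    ((hf.pdy (m := 0) hW (by simp)).continuousOn.pow 2)).sqrt

lemma SQ_eq_Icc : SQ = Icc ((0 : ℝ), (0 : ℝ)) (1, 1) := Icc_prod_Icc _ _ _ _

lemma SQo_subset_SQ : SQo ⊆ SQ := prod_mono Ioo_subset_Icc_self Ioo_subset_Icc_self

lemma SQo_ae_eq_SQ : SQo =ᵐ[volume] SQ :=
  Measure.set_prod_ae_eq Ioo_ae_eq_Icc Ioo_ae_eq_Icc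

lemma isCompact_SQ : IsCompact SQ := isCompact_Icc.prod isCompact_Icc

/-- Green's formula on the unit square for a divergence-free field `(P, Q)` that is tangential
on the left and right edges. -/
lemma setIntegral_field_dot_grad {P Q v : ℝ × ℝ → ℝ} {W : Set (ℝ × ℝ)} (hW : IsOpen W)
    (hSQ : SQ ⊆ W) (hP : ContDiffOn ℝ 1 P W) (hQ : ContDiffOn ℝ 1 Q W) (hv : ContDiffOn ℝ 1 v W)
    (hdiv : ∀ p ∈ SQo, pdx P p + pdy Q p = 0)
    (hl : ∀ y ∈ Icc (0 : ℝ) 1, P (0, y) = 0) (hr : ∀ y ∈ Icc (0 : ℝ) 1, P (1, y) = 0) :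
    ∫ p in SQo, (P p * pdx v p + Q p * pdy v p) =
      (∫ x in (0 : ℝ)..1, Q (x, 1) * v (x, 1)) - ∫ x in (0 : ℝ)..1, Q (x, 0) * v (x, 0) := by
  have hd : ∀ {f : ℝ × ℝ → ℝ}, ContDiffOn ℝ 1 f W → ∀ p ∈ W, DifferentiableAt ℝ f p :=
    fun hf p hp => (hf.differentiableOn one_ne_zero).differentiableAt (hW.mem_nhds hp)
  have hPv := hP.mul hv
  have hQv := hQ.mul hv
  have hcont : ContinuousOn (fun p => fderiv ℝ (fun q => P q * v q) p (1, 0)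
      + fderiv ℝ (fun q => Q q * v q) p (0, 1)) W :=
    ((hPv.continuousOn_fderiv_of_isOpen hW le_rfl).clm_apply continuousOn_const).add
      ((hQv.continuousOn_fderiv_of_isOpen hW le_rfl).clm_apply continuousOn_const)
  have key := integral_divergence_prod_Icc_of_hasFDerivAt_of_le (fun q => P q * v q)
    (fun q => Q q * v q) (fderiv ℝ (fun q => P q * v q)) (fderiv ℝ (fun q => Q q * v q))
    ((0 : ℝ), (0 : ℝ)) (1, 1) (by simp [Prod.le_def])
    (by rw [← SQ_eq_Icc]; exact hPv.continuousOn.mono hSQ)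
    (by rw [← SQ_eq_Icc]; exact hQv.continuousOn.mono hSQ)
    (fun p hp => (hd hPv p (hSQ (SQo_subset_SQ hp))).hasFDerivAt)
    (fun p hp => (hd hQv p (hSQ (SQo_subset_SQ hp))).hasFDerivAt)
    (by rw [← SQ_eq_Icc]; exact (hcont.mono hSQ).integrableOn_compact isCompact_SQ)
  have hzero : ∀ c : ℝ, (∀ y ∈ Icc (0 : ℝ) 1, P (c, y) = 0) →
      ∫ y in (0 : ℝ)..1, P (c, y) * v (c, y) = 0 := fun c hc =>
    intervalIntegral.integral_zero_ae <| .of_forall fun y hy => by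
      rw [uIoc_of_le zero_le_one] at hy
      rw [hc y (Ioc_subset_Icc_self hy), zero_mul]
  rw [← SQ_eq_Icc, ← setIntegral_congr_set SQo_ae_eq_SQ] at key
  simp only [hzero 0 hl, hzero 1 hr, add_zero, sub_zero] at key
  rw [← key]
  refine setIntegral_congr_fun (measurableSet_Ioo.prod measurableSet_Ioo) fun p hp => ?_
  have hpW := hSQ (SQo_subset_SQ hp)
  have hdp := hdiv p hp
  rw [fderiv_fun_mul (hd hP p hpW) (hd hv p hpW), fderiv_fun_mul (hd hQ p hpW) (hd hv p hpW),
    pdx_eq_fderiv (hd hv p hpW), pdy_eq_fderiv (hd hv p hpW)]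
  rw [pdx_eq_fderiv (hd hP p hpW), pdy_eq_fderiv (hd hQ p hpW)] at hdp
  simp only [add_apply, smul_apply, smul_eq_mul]
  linear_combination -v p * hdp

/-- Cauchy–Schwarz for gradients in the plane. -/
lemma grad_dot_grad_le (u v : ℝ × ℝ → ℝ) (p : ℝ × ℝ) :
    pdx u p * pdx v p + pdy u p * pdy v p ≤ gradNorm u p * gradNorm v p := by
  rw [gradNorm, gradNorm, ← Real.sqrt_mul (by positivity)]
  apply Real.le_sqrt_of_sq_le
  nlinarith [sq_nonneg (pdx u p * pdy v p - pdy u p * pdx v p)]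

lemma gradNorm_mul_self (u : ℝ × ℝ → ℝ) (p : ℝ × ℝ) :
    gradNorm u p * gradNorm u p = pdx u p * pdx u p + pdy u p * pdy u p := by
  rw [gradNorm, Real.mul_self_sqrt (by positivity)]
  ring

/-- The contribution of one electrode, with current density `(U - f) / z`, to the comparison of
the least-gradient functional at `(f, U)` and `(g, V)`. -/
lemma electrode_inequality {f g j : ℝ → ℝ} {z U V I : ℝ} (hz : 0 < z)
    (hf : ContinuousOn f (Icc 0 1)) (hg : ContinuousOn g (Icc 0 1))
    (hj : ∀ x ∈ Icc (0 : ℝ) 1, z * j x = U - f x) (hI : ∫ x in (0 : ℝ)..1, j x = I) :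
    (1 / (2 * z)) * (∫ x in (0 : ℝ)..1, (f x - U) ^ 2) - I * U + (∫ x in (0 : ℝ)..1, j x * f x) ≤
      (1 / (2 * z)) * (∫ x in (0 : ℝ)..1, (g x - V) ^ 2) - I * V
        + ∫ x in (0 : ℝ)..1, j x * g x := by
  have hjc : ContinuousOn j (Icc 0 1) := by
    refine ((continuousOn_const (c := U)).sub hf |>.div_const z).congr fun x hx => ?_
    simp only [Pi.sub_apply]
    rw [← hj x hx, mul_div_cancel_left₀ _ hz.ne']
  have hi : ∀ {h : ℝ → ℝ}, ContinuousOn h (Icc 0 1) → IntervalIntegrable h volume 0 1 :=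
    fun hh => ContinuousOn.intervalIntegrable_of_Icc zero_le_one hh
  have expand : ∀ {h : ℝ → ℝ} (T : ℝ), ContinuousOn h (Icc 0 1) →
      IntervalIntegrable (fun x => 1 / (2 * z) * (h x - T) ^ 2 - j x * T + j x * h x) volume 0 1 ∧
      (∫ x in (0 : ℝ)..1, (1 / (2 * z) * (h x - T) ^ 2 - j x * T + j x * h x)) =
        1 / (2 * z) * (∫ x in (0 : ℝ)..1, (h x - T) ^ 2) - I * T
          + ∫ x in (0 : ℝ)..1, j x * h x := by
    intro h T hh
    have h1 : IntervalIntegrable (fun x => 1 / (2 * z) * (h x - T) ^ 2) volume 0 1 :=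
      hi (by fun_prop)
    have h2 : IntervalIntegrable (fun x => j x * T) volume 0 1 := hi (by fun_prop)
    have h3 : IntervalIntegrable (fun x => j x * h x) volume 0 1 := hi (by fun_prop)
    refine ⟨(h1.sub h2).add h3, ?_⟩
    rw [intervalIntegral.integral_add (h1.sub h2) h3, intervalIntegral.integral_sub h1 h2,
      intervalIntegral.integral_const_mul, intervalIntegral.integral_mul_const, hI]
  rw [← (expand U hf).2, ← (expand V hg).2]
  refine intervalIntegral.integral_mono_on zero_le_one (expand U hf).1 (expand V hg).1
    fun x hx => ?_
  have hfx : f x = U - z * j x := by linarith [hj x hx]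
  have hsq : 0 ≤ 1 / (2 * z) * (g x - V - (f x - U)) ^ 2 := by positivity
  rw [hfx] at hsq ⊢
  have : 1 / (2 * z) * (g x - V) ^ 2 - j x * V + j x * g x
      - (1 / (2 * z) * (U - z * j x - U) ^ 2 - j x * U + j x * (U - z * j x)) =
      1 / (2 * z) * (g x - V - (U - z * j x - U)) ^ 2 := by
    field_simp
    ring
  linarith

/-- The CEM solution `(u, U)` is a global minimizer of the weighted least-gradient
functional `G_a` with weight `a = σ|∇u|`. -/
theorem cem_solution_minimizes_Ga (σ u : ℝ × ℝ → ℝ) (U₀ U₁ z₀ z₁ I₀ I₁ : ℝ)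
    (hσ : ∃ W : Set (ℝ × ℝ), IsOpen W ∧ SQ ⊆ W ∧ ContDiffOn ℝ 1 σ W)
    (hσpos : ∀ p ∈ SQ, 0 < σ p)
    (hz₀ : 0 < z₀) (hz₁ : 0 < z₁) (hI : I₀ + I₁ = 0)
    (hsol : IsCEMSolution σ u U₀ U₁ z₀ z₁ I₀ I₁) :
    ∀ v : ℝ × ℝ → ℝ, C1Nbhd v → ∀ V₀ V₁ : ℝ, V₀ + V₁ = 0 →
      Gfun (fun p => σ p * gradNorm u p) z₀ z₁ I₀ I₁ u U₀ U₁ ≤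
        Gfun (fun p => σ p * gradNorm u p) z₀ z₁ I₀ I₁ v V₀ V₁ := by
  obtain ⟨Wσ, hWσ, hSσ, hσ⟩ := hσ
  obtain ⟨Wu, hWu, hSu, hu⟩ := hsol.smooth
  rintro v ⟨Wv, hWv, hSv, hv⟩ V₀ V₁ -
  obtain ⟨W, hW, hSQ, hσ, hu, hv⟩ : ∃ W, IsOpen W ∧ SQ ⊆ W ∧ ContDiffOn ℝ 1 σ W ∧
      ContDiffOn ℝ 2 u W ∧ ContDiffOn ℝ 1 v W :=
    ⟨Wσ ∩ (Wu ∩ Wv), hWσ.inter (hWu.inter hWv), subset_inter hSσ (subset_inter hSu hSv),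
      hσ.mono fun _ h => h.1, hu.mono fun _ h => h.2.1, hv.mono fun _ h => h.2.2⟩
  have hu1 : ContDiffOn ℝ 1 u W := hu.of_le one_le_two
  have hux : ContDiffOn ℝ 1 (pdx u) W := hu.pdx hW (by norm_num [one_add_one_eq_two])
  have huy : ContDiffOn ℝ 1 (pdy u) W := hu.pdy hW (by norm_num [one_add_one_eq_two])
  have green : ∀ {w : ℝ × ℝ → ℝ}, ContDiffOn ℝ 1 w W →
      ∫ p in SQo, (σ p * pdx u p * pdx w p + σ p * pdy u p * pdy w p) =
        (∫ x in (0 : ℝ)..1, σ (x, 1) * pdy u (x, 1) * w (x, 1))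
          - ∫ x in (0 : ℝ)..1, σ (x, 0) * pdy u (x, 0) * w (x, 0) := fun hw =>
    setIntegral_field_dot_grad hW hSQ (hσ.mul hux) (hσ.mul huy) hw hsol.pde
      (fun y hy => by simp [hsol.noflux_left y hy]) (fun y hy => by simp [hsol.noflux_right y hy])
  have hint : ∀ {h : ℝ × ℝ → ℝ}, ContinuousOn h W → IntegrableOn h SQo := fun hh =>
    ((hh.mono hSQ).integrableOn_compact isCompact_SQ).mono_set SQo_subset_SQ
  have hbulk_u : ∫ p in SQo, σ p * gradNorm u p * gradNorm u p =
      ∫ p in SQo, (σ p * pdx u p * pdx u p + σ p * pdy u p * pdy u p) := by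
    congr 1 with p
    linear_combination σ p * gradNorm_mul_self u p
  have hbulk_v : ∫ p in SQo, (σ p * pdx u p * pdx v p + σ p * pdy u p * pdy v p) ≤
      ∫ p in SQo, σ p * gradNorm u p * gradNorm v p := by
    refine setIntegral_mono_on (hint ?_) (hint ?_) (measurableSet_Ioo.prod measurableSet_Ioo)
      fun p hp => ?_
    · exact ((hσ.mul hux).continuousOn.mul (hv.pdx (m := 0) hW (by simp)).continuousOn).add
        ((hσ.mul huy).continuousOn.mul (hv.pdy (m := 0) hW (by simp)).continuousOn)
    · exact (hσ.continuousOn.mul (continuousOn_gradNorm hu1 hW)).mul (continuousOn_gradNorm hv hW)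
    · linarith [mul_le_mul_of_nonneg_left (grad_dot_grad_le u v p)
        (hσpos p (SQo_subset_SQ hp)).le]
  have trace : ∀ {w : ℝ × ℝ → ℝ}, ContDiffOn ℝ 1 w W → ∀ c ∈ Icc (0 : ℝ) 1,
      ContinuousOn (fun x : ℝ => w (x, c)) (Icc 0 1) := fun hw c hc =>
    hw.continuousOn.comp (by fun_prop) fun x hx => hSQ ⟨hx, hc⟩
  have h0 : (0 : ℝ) ∈ Icc (0 : ℝ) 1 := by simp
  have h1 : (1 : ℝ) ∈ Icc (0 : ℝ) 1 := by simp
  have bot := electrode_inequality (U := U₀) (V := V₀) hz₀ (trace hu1 0 h0) (trace hv 0 h0)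
    (j := fun x => -(σ (x, 0) * pdy u (x, 0)))
    (fun x hx => by linarith [hsol.robin_bot x hx]) hsol.flux_bot
  have top := electrode_inequality (U := U₁) (V := V₁) hz₁ (trace hu1 1 h1) (trace hv 1 h1)
    (j := fun x => σ (x, 1) * pdy u (x, 1))
    (fun x hx => by linarith [hsol.robin_top x hx]) hsol.flux_top
  simp only [neg_mul, intervalIntegral.integral_neg] at bot
  simp only [Gfun]
  rw [hbulk_u, green hu1]
  rw [green hv] at hbulk_v
  linarith
end

section
/- Let Ω ⊆ ℝⁿ be open, let u, v : Ω → ℝ be continuously differentiable, and let σ, σ̃ : Ω → ℝ be continuous and positive. Assume that σ(x)|∇u(x)| = σ̃(x)|∇v(x)| for all x ∈ Ω and that the gradients are aligned: ⟨∇u(x), ∇v(x)⟩ = |∇u(x)|·|∇v(x)| for all x ∈ Ω. Let x₀ ∈ Ω satisfy ∇u(x₀) ≠ 0. Then there exist an open neighborhood O₀ ⊆ Ω of x₀ and a function φ : ℝ → ℝ which is continuously differentiable with φ' > 0 on u(O₀), such that v = φ∘u on O₀ and σ̃(x) = σ(x)/φ'(u(x)) for all x ∈ O₀. -/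
open Set RealInnerProductSpace

theorem hasFDerivAt_inner_sub_const {E : Type*} [NormedAddCommGroup E] [InnerProductSpace ℝ E]
    (g a y : E) : HasFDerivAt (fun x : E => ⟪g, x - a⟫) (innerSL ℝ g) y := by
  simp_rw [inner_sub_right]
  exact (innerSL ℝ g).hasFDerivAt.sub_const ⟪g, a⟫

/-- Near a non-critical point, a `C¹` function becomes affine in suitable `C¹` coordinates. -/
theorem exists_openPartialHomeomorph_inner_eq {E : Type*} [NormedAddCommGroup E]
    [InnerProductSpace ℝ E] [CompleteSpace E] {u : E → ℝ} {x₀ : E}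
    (hu : ContDiffAt ℝ 1 u x₀) (hcrit : gradient u x₀ ≠ 0) :
    ∃ e : OpenPartialHomeomorph E E, x₀ ∈ e.source ∧ e x₀ = x₀ ∧ ContDiffAt ℝ 1 e.symm x₀ ∧
      ∀ x, ⟪gradient u x₀, e x - x₀⟫ = u x - u x₀ := by
  set g := gradient u x₀
  have hgg : ⟪g, g⟫ ≠ 0 := inner_self_ne_zero.2 hcrit
  let F : E → E := fun x => x + (u x - u x₀ - ⟪g, x - x₀⟫) • (⟪g, g⟫⁻¹ • g)
  have hF : ContDiffAt ℝ 1 F x₀ := by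
    have h : ContDiffAt ℝ 1 (fun x : E => ⟪g, x - x₀⟫) x₀ :=
      contDiffAt_const.inner ℝ (contDiffAt_id.sub contDiffAt_const)
    exact contDiffAt_id.add (((hu.sub contDiffAt_const).sub h).smul contDiffAt_const)
  have hux : HasFDerivAt u (innerSL ℝ g) x₀ :=
    (hu.differentiableAt one_ne_zero).hasGradientAt.hasFDerivAt
  have hF' : HasFDerivAt F ((ContinuousLinearEquiv.refl ℝ E : E ≃L[ℝ] E) : E →L[ℝ] E) x₀ := by
    have h := (hasFDerivAt_id x₀).add
      (((hux.sub_const (u x₀)).sub (hasFDerivAt_inner_sub_const g x₀ x₀)).smul_const (⟪g, g⟫⁻¹ • g))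
    rw [sub_self] at h
    refine h.congr_fderiv ?_
    ext y
    simp
  have hFx₀ : F x₀ = x₀ := by simp [F]
  refine ⟨hF.toOpenPartialHomeomorph F hF' one_ne_zero,
    hF.mem_toOpenPartialHomeomorph_source hF' one_ne_zero, hFx₀, ?_, fun x => ?_⟩
  · have h := hF.to_localInverse hF' one_ne_zero
    rw [hFx₀] at h
    exact h
  · change ⟪g, F x - x₀⟫ = _
    simp only [F, inner_sub_right, inner_add_right, inner_smul_right]
    field_simp
    ring

/-- A function on a ball whose derivative vanishes on the orthogonal complement of `g` depends
only on the inner product with `g`. -/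
theorem eq_apply_orthogonal_projection_of_fderiv_eq_zero {E : Type*} [NormedAddCommGroup E]
    [InnerProductSpace ℝ E] {w : E → ℝ} {g x₀ : E} {r : ℝ} (hg : g ≠ 0)
    (hw : ∀ y ∈ Metric.ball x₀ r, DifferentiableAt ℝ w y)
    (hw' : ∀ y ∈ Metric.ball x₀ r, ∀ h, ⟪g, h⟫ = 0 → fderiv ℝ w y h = 0)
    {y : E} (hy : y ∈ Metric.ball x₀ r) :
    x₀ + ⟪g, y - x₀⟫ • (⟪g, g⟫⁻¹ • g) ∈ Metric.ball x₀ r ∧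
      w y = w (x₀ + ⟪g, y - x₀⟫ • (⟪g, g⟫⁻¹ • g)) := by
  have hgg : ⟪g, g⟫ ≠ 0 := inner_self_ne_zero.2 hg
  have hmem : x₀ + ⟪g, y - x₀⟫ • (⟪g, g⟫⁻¹ • g) ∈ Metric.ball x₀ r := by
    have hn : 0 < ‖g‖ := norm_pos_iff.2 hg
    rw [mem_ball_iff_norm] at hy ⊢
    refine lt_of_le_of_lt ?_ hy
    rw [add_sub_cancel_left, norm_smul, norm_smul, norm_inv, real_inner_self_eq_norm_sq,
      norm_pow, norm_norm]
    calc ‖⟪g, y - x₀⟫‖ * ((‖g‖ ^ 2)⁻¹ * ‖g‖)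
        ≤ (‖g‖ * ‖y - x₀‖) * ((‖g‖ ^ 2)⁻¹ * ‖g‖) := by
          gcongr
          exact norm_inner_le_norm g (y - x₀)
      _ = ‖y - x₀‖ := by field_simp
  refine ⟨hmem, ?_⟩
  obtain ⟨z, hz, h⟩ := domain_mvt
    (fun z hz => (hw z hz).hasFDerivAt.hasFDerivWithinAt) (convex_ball x₀ r) hmem hy
  rw [← sub_eq_zero, h]
  refine hw' z ((convex_ball x₀ r).segment_subset hmem hy hz) _ ?_
  rw [← sub_sub, inner_sub_right, inner_smul_right, inner_smul_right, inv_mul_cancel₀ hgg]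
  simp

/-- If `∇v` is a nonnegative multiple of `∇u ≠ 0`, then `v` is locally a `C¹` function of `u`. -/
theorem exists_comp_eq_of_aligned_gradient {E : Type*} [NormedAddCommGroup E]
    [InnerProductSpace ℝ E] [CompleteSpace E] {Ω : Set E} (hΩ : IsOpen Ω) {u v : E → ℝ}
    (hu : ContDiffOn ℝ 1 u Ω) (hv : ContDiffOn ℝ 1 v Ω)
    (halign : ∀ x ∈ Ω, ⟪gradient u x, gradient v x⟫ = ‖gradient u x‖ * ‖gradient v x‖)
    {x₀ : E} (hx₀ : x₀ ∈ Ω) (hcrit : gradient u x₀ ≠ 0) :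
    ∃ O₀ : Set E, IsOpen O₀ ∧ x₀ ∈ O₀ ∧ O₀ ⊆ Ω ∧ ∃ φ : ℝ → ℝ,
      ∀ x ∈ O₀, gradient u x ≠ 0 ∧ ContDiffAt ℝ 1 φ (u x) ∧ v x = φ (u x) := by
  have hu' : ∀ x ∈ Ω, ContDiffAt ℝ 1 u x := fun x hx => hu.contDiffAt (hΩ.mem_nhds hx)
  have hv' : ∀ x ∈ Ω, ContDiffAt ℝ 1 v x := fun x hx => hv.contDiffAt (hΩ.mem_nhds hx)
  obtain ⟨e, hes, hex₀, hesymm, he⟩ := exists_openPartialHomeomorph_inner_eq (hu' x₀ hx₀) hcrit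
  set g := gradient u x₀
  have hgx₀ : e.symm x₀ = x₀ := by
    conv_lhs => rw [← hex₀]
    exact e.left_inv hes
  have het : x₀ ∈ e.target := hex₀ ▸ e.map_source hes
  obtain ⟨r, hr, hball⟩ := Metric.eventually_nhds_iff_ball.1
    (((e.open_target.eventually_mem het).and (hesymm.continuousAt.eventually_mem
      (hΩ.mem_nhds (hgx₀.symm ▸ hx₀)))).and (hesymm.eventually (by simp)))
  have hderiv : ∀ y ∈ Metric.ball x₀ r, ∀ h,
      ⟪gradient u (e.symm y), fderiv ℝ e.symm y h⟫ = ⟪g, h⟫ := by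
    intro y hy h
    obtain ⟨⟨hyt, hyΩ⟩, hyc⟩ := hball y hy
    have h1 : HasFDerivAt (u ∘ e.symm) _ y :=
      ((hu' _ hyΩ).differentiableAt one_ne_zero).hasGradientAt.hasFDerivAt.comp y
        (hyc.differentiableAt one_ne_zero).hasFDerivAt
    have h2 : HasFDerivAt (fun z : E => u x₀ + ⟪g, z - x₀⟫) (innerSL ℝ g) y :=
      (hasFDerivAt_inner_sub_const g x₀ y).const_add (u x₀)
    have h3 : u ∘ e.symm =ᶠ[nhds y] fun z => u x₀ + ⟪g, z - x₀⟫ := by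
      filter_upwards [e.open_target.mem_nhds hyt] with z hz
      have := he (e.symm z)
      rw [e.right_inv hz] at this
      simp [this]
    simpa using DFunLike.congr_fun (h1.unique (h2.congr_of_eventuallyEq h3)) h
  have hne : ∀ y ∈ Metric.ball x₀ r, gradient u (e.symm y) ≠ 0 := by
    intro y hy h0
    have h := hderiv y hy g
    rw [h0, inner_zero_left] at h
    exact hcrit (inner_self_eq_zero.1 h.symm)
  have hwc : ∀ y ∈ Metric.ball x₀ r, ContDiffAt ℝ 1 (v ∘ e.symm) y := fun y hy =>
    (hv' _ (hball y hy).1.2).comp y (hball y hy).2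
  have hw' : ∀ y ∈ Metric.ball x₀ r, ∀ h, ⟪g, h⟫ = 0 → fderiv ℝ (v ∘ e.symm) y h = 0 := by
    intro y hy h hgh
    obtain ⟨⟨hyt, hyΩ⟩, hyc⟩ := hball y hy
    have h1 : HasFDerivAt (v ∘ e.symm) _ y :=
      ((hv' _ hyΩ).differentiableAt one_ne_zero).hasGradientAt.hasFDerivAt.comp y
        (hyc.differentiableAt one_ne_zero).hasFDerivAt
    have h2 : ⟪gradient v (e.symm y), fderiv ℝ e.symm y h⟫ = 0 := by
      have h3 := congrArg (fun z => ⟪z, fderiv ℝ e.symm y h⟫)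
        (inner_eq_norm_mul_iff_real.1 (halign _ hyΩ))
      simp only [inner_smul_left, hderiv y hy h, hgh] at h3
      simpa [hne y hy] using h3
    rw [h1.fderiv]
    simpa using h2
  refine ⟨e.source ∩ e ⁻¹' Metric.ball x₀ r, e.isOpen_inter_preimage Metric.isOpen_ball,
    ⟨hes, by simpa [hex₀] using hr⟩, fun x hx => ?_,
    fun t => (v ∘ e.symm) (x₀ + (t - u x₀) • (⟪g, g⟫⁻¹ • g)), fun x hx => ⟨?_, ?_, ?_⟩⟩
  · exact e.left_inv hx.1 ▸ (hball _ hx.2).1.2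
  · exact e.left_inv hx.1 ▸ hne _ hx.2
  · have h := (eq_apply_orthogonal_projection_of_fderiv_eq_zero hcrit
      (fun y hy => (hwc y hy).differentiableAt one_ne_zero) hw' hx.2).1
    rw [he x] at h
    exact ContDiffAt.comp (g := v ∘ e.symm) (u x) (hwc _ h) (contDiffAt_const.add
      ((contDiffAt_id.sub contDiffAt_const).smul contDiffAt_const))
  · have h := (eq_apply_orthogonal_projection_of_fderiv_eq_zero hcrit
      (fun y hy => (hwc y hy).differentiableAt one_ne_zero) hw' hx.2).2
    rw [he x] at h
    beta_reduce
    rw [← h, Function.comp_apply, e.left_inv hx.1]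

/-- Local characterization of non-uniqueness: near a non-critical point of `u`, two pairs
`(σ, u)` and `(σ̃, v)` producing the same aligned current magnitude are related by
`v = φ ∘ u` and `σ̃ = σ/(φ' ∘ u)` for an increasing `C¹` function `φ`. -/
theorem local_characterization_nonuniqueness {n : ℕ}
    (Ω : Set (EuclideanSpace ℝ (Fin n))) (hΩ : IsOpen Ω)
    (u v σ σt : EuclideanSpace ℝ (Fin n) → ℝ)
    (hu : ContDiffOn ℝ 1 u Ω) (hv : ContDiffOn ℝ 1 v Ω)
    (hσc : ContinuousOn σ Ω) (hσtc : ContinuousOn σt Ω)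
    (hσpos : ∀ x ∈ Ω, 0 < σ x) (hσtpos : ∀ x ∈ Ω, 0 < σt x)
    (hmag : ∀ x ∈ Ω, σ x * ‖gradient u x‖ = σt x * ‖gradient v x‖)
    (halign : ∀ x ∈ Ω, ⟪gradient u x, gradient v x⟫ = ‖gradient u x‖ * ‖gradient v x‖)
    (x₀ : EuclideanSpace ℝ (Fin n)) (hx₀ : x₀ ∈ Ω) (hcrit : gradient u x₀ ≠ 0) :
    ∃ O₀ : Set (EuclideanSpace ℝ (Fin n)), IsOpen O₀ ∧ x₀ ∈ O₀ ∧ O₀ ⊆ Ω ∧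
      ∃ φ : ℝ → ℝ,
        (∀ t ∈ u '' O₀, ContDiffAt ℝ 1 φ t ∧ 0 < deriv φ t) ∧
        (∀ x ∈ O₀, v x = φ (u x) ∧ σt x = σ x / deriv φ (u x)) := by
  obtain ⟨O₀, hO, hxO, hOΩ, φ, hφ⟩ :=
    exists_comp_eq_of_aligned_gradient hΩ hu hv halign hx₀ hcrit
  have key : ∀ x ∈ O₀, 0 < deriv φ (u x) ∧ σt x = σ x / deriv φ (u x) := by
    intro x hx
    obtain ⟨hne, hφx, -⟩ := hφ x hx
    have hxΩ := hOΩ hx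
    have hux := ((hu.contDiffAt (hΩ.mem_nhds hxΩ)).differentiableAt one_ne_zero).hasGradientAt
    have hgrad : gradient v x = deriv φ (u x) • gradient u x := by
      have h : HasFDerivAt v (deriv φ (u x) • (InnerProductSpace.toDual ℝ _ (gradient u x))) x :=
        ((hφx.differentiableAt one_ne_zero).hasDerivAt.comp_hasFDerivAt x
          hux.hasFDerivAt).congr_of_eventuallyEq <| by
            filter_upwards [hO.mem_nhds hx] with z hz using (hφ z hz).2.2
      refine HasGradientAt.gradient (hasGradientAt_iff_hasFDerivAt.2 ?_)
      simpa using h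
    have hn : 0 < ‖gradient u x‖ := norm_pos_iff.2 hne
    have hm := hmag x hxΩ
    have ha := halign x hxΩ
    rw [hgrad, norm_smul, Real.norm_eq_abs] at hm ha
    rw [inner_smul_right, real_inner_self_eq_norm_sq] at ha
    have habs : deriv φ (u x) = |deriv φ (u x)| := by
      refine mul_right_cancel₀ (pow_pos hn 2).ne' ?_
      linarith
    have hσ : σ x = σt x * deriv φ (u x) := by
      rw [habs]
      refine mul_right_cancel₀ hn.ne' ?_
      linarith
    have hpos : 0 < deriv φ (u x) :=
      (pos_iff_pos_of_mul_pos (hσ ▸ hσpos x hxΩ)).1 (hσtpos x hxΩ)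
    exact ⟨hpos, by rw [hσ, mul_div_cancel_right₀ _ hpos.ne']⟩
  refine ⟨O₀, hO, hxO, hOΩ, φ, ?_, fun x hx => ⟨(hφ x hx).2.2, (key x hx).2⟩⟩
  rintro _ ⟨x, hx, rfl⟩
  exact ⟨(hφ x hx).2.1, (key x hx).1⟩
end

section
/- There exists a constant C > 0 such that for every function u that is continuously differentiable on an open neighborhood of the closed unit square [0,1]×[0,1] and every pair (U₀, U₁) ∈ ℝ² with U₀ + U₁ = 0, we have ∫_Ω u² dxdy + U₀² + U₁² ≤ C ( ∫_Ω |∇u|² dxdy + ∫₀¹ (u(x,0) − U₀)² dx + ∫₀¹ (u(x,1) − U₁)² dx ), where Ω = (0,1)×(0,1). -/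
open MeasureTheory Set

/-- One-dimensional estimate: the increment of a `C¹` function on `[0, 1]` is controlled by the
`L²` norm of its derivative. -/
lemma sq_sub_le_integral_deriv_sq {f f' : ℝ → ℝ}
    (hf : ∀ t ∈ Icc (0 : ℝ) 1, HasDerivAt f (f' t) t) (hf' : ContinuousOn f' (Icc 0 1))
    {y : ℝ} (hy : y ∈ Icc (0 : ℝ) 1) :
    (f y - f 0) ^ 2 ≤ ∫ t in (0 : ℝ)..1, f' t ^ 2 := by
  have hsub : uIcc 0 y ⊆ Icc (0 : ℝ) 1 := by
    rw [uIcc_of_le hy.1]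
    exact Icc_subset_Icc_right hy.2
  have hc : ContinuousOn f' (uIcc 0 y) := hf'.mono hsub
  have hftc : ∫ t in (0 : ℝ)..y, f' t = f y - f 0 :=
    intervalIntegral.integral_eq_sub_of_hasDerivAt (fun t ht => hf t (hsub ht))
      hc.intervalIntegrable
  set c := f y - f 0 with hcdef
  have hnonneg : 0 ≤ ∫ t in (0 : ℝ)..y, (f' t - c) ^ 2 :=
    intervalIntegral.integral_nonneg hy.1 fun t _ => sq_nonneg _
  have hexpand : ∫ t in (0 : ℝ)..y, (f' t - c) ^ 2
      = (∫ t in (0 : ℝ)..y, f' t ^ 2) - 2 * c * c + y * c ^ 2 := by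
    have h1 : IntervalIntegrable (fun t => f' t ^ 2) volume 0 y := (hc.pow 2).intervalIntegrable
    have h2 : IntervalIntegrable (fun t => 2 * c * f' t) volume 0 y :=
      (continuousOn_const.mul hc).intervalIntegrable
    have h3 : IntervalIntegrable (fun _ => c ^ 2) volume 0 y :=
      continuousOn_const.intervalIntegrable
    calc ∫ t in (0 : ℝ)..y, (f' t - c) ^ 2
        = ∫ t in (0 : ℝ)..y, (f' t ^ 2 - 2 * c * f' t + c ^ 2) := by
          congr 1
          ext t
          ring
      _ = _ := by
          rw [intervalIntegral.integral_add (h1.sub h2) h3, intervalIntegral.integral_sub h1 h2,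
            intervalIntegral.integral_const_mul, intervalIntegral.integral_const, hftc]
          simp
  have hmono : ∫ t in (0 : ℝ)..y, f' t ^ 2 ≤ ∫ t in (0 : ℝ)..1, f' t ^ 2 := by
    refine intervalIntegral.integral_mono_interval le_rfl hy.1 hy.2
      (Filter.Eventually.of_forall fun t => sq_nonneg _) ?_
    refine ContinuousOn.intervalIntegrable ?_
    rw [uIcc_of_le zero_le_one]
    exact hf'.pow 2
  nlinarith [sq_nonneg c, hy.2, mul_nonneg (sub_nonneg.2 hy.2) (sq_nonneg c)]

/-- A `C¹` function on `[0, 1]` is controlled by its derivative and its deviations at the endpoints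
from two opposite values. -/
lemma sq_add_two_mul_sq_le {f f' : ℝ → ℝ}
    (hf : ∀ t ∈ Icc (0 : ℝ) 1, HasDerivAt f (f' t) t) (hf' : ContinuousOn f' (Icc 0 1))
    {y : ℝ} (hy : y ∈ Icc (0 : ℝ) 1) (U : ℝ) :
    f y ^ 2 + 2 * U ^ 2 ≤
      10 * ((∫ t in (0 : ℝ)..1, f' t ^ 2) + (f 0 - U) ^ 2 + (f 1 + U) ^ 2) := by
  have h1 := sq_sub_le_integral_deriv_sq hf hf' (right_mem_Icc.2 zero_le_one)
  have h2 := sq_sub_le_integral_deriv_sq hf hf' hy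
  set G := ∫ t in (0 : ℝ)..1, f' t ^ 2
  have hU : U ^ 2 ≤ 3 / 4 * ((f 0 - U) ^ 2 + (f 1 + U) ^ 2 + (f 1 - f 0) ^ 2) := by
    nlinarith [sq_nonneg ((f 0 - U) + (f 1 + U)), sq_nonneg ((f 0 - U) - (f 1 - f 0)),
      sq_nonneg ((f 1 + U) + (f 1 - f 0))]
  have hy' : f y ^ 2 ≤ 3 * ((f y - f 0) ^ 2 + (f 0 - U) ^ 2 + U ^ 2) := by
    nlinarith [sq_nonneg ((f y - f 0) - (f 0 - U)), sq_nonneg ((f y - f 0) - U),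
      sq_nonneg ((f 0 - U) - U)]
  nlinarith [sq_nonneg (f 0 - U), sq_nonneg (f 1 + U), sq_nonneg (f 1 - f 0)]

lemma C1Nbhd.continuousOn {u : ℝ × ℝ → ℝ} (hu : C1Nbhd u) : ContinuousOn u SQ := by
  obtain ⟨W, -, hSW, hW⟩ := hu
  exact hW.continuousOn.mono hSW

lemma C1Nbhd.differentiableAt {u : ℝ × ℝ → ℝ} (hu : C1Nbhd u) {p : ℝ × ℝ} (hp : p ∈ SQ) :
    DifferentiableAt ℝ u p := by
  obtain ⟨W, hWo, hSW, hW⟩ := hu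
  exact (hW.differentiableOn one_ne_zero).differentiableAt (hWo.mem_nhds (hSW hp))

lemma C1Nbhd.continuousOn_fderiv {u : ℝ × ℝ → ℝ} (hu : C1Nbhd u) :
    ContinuousOn (fderiv ℝ u) SQ := by
  obtain ⟨W, hWo, hSW, hW⟩ := hu
  exact (hW.continuousOn_fderiv_of_isOpen hWo le_rfl).mono hSW

lemma hasDerivAt_fst_slice {u : ℝ × ℝ → ℝ} {p : ℝ × ℝ} (hu : DifferentiableAt ℝ u p) :
    HasDerivAt (fun t => u (t, p.2)) (fderiv ℝ u p (1, 0)) p.1 :=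
  hu.hasFDerivAt.comp_hasDerivAt p.1 ((hasDerivAt_id p.1).prodMk (hasDerivAt_const p.1 p.2))

lemma hasDerivAt_snd_slice {u : ℝ × ℝ → ℝ} {p : ℝ × ℝ} (hu : DifferentiableAt ℝ u p) :
    HasDerivAt (fun t => u (p.1, t)) (fderiv ℝ u p (0, 1)) p.2 :=
  hu.hasFDerivAt.comp_hasDerivAt p.2 ((hasDerivAt_const p.2 p.1).prodMk (hasDerivAt_id p.2))

lemma C1Nbhd.continuousOn_pdx {u : ℝ × ℝ → ℝ} (hu : C1Nbhd u) : ContinuousOn (pdx u) SQ :=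
  (hu.continuousOn_fderiv.clm_apply continuousOn_const).congr fun _ hp =>
    (hasDerivAt_fst_slice (hu.differentiableAt hp)).deriv

lemma C1Nbhd.continuousOn_pdy {u : ℝ × ℝ → ℝ} (hu : C1Nbhd u) : ContinuousOn (pdy u) SQ :=
  (hu.continuousOn_fderiv.clm_apply continuousOn_const).congr fun _ hp =>
    (hasDerivAt_snd_slice (hu.differentiableAt hp)).deriv

lemma C1Nbhd.hasDerivAt_pdy {u : ℝ × ℝ → ℝ} (hu : C1Nbhd u) {x y : ℝ} (hp : (x, y) ∈ SQ) :
    HasDerivAt (fun t => u (x, t)) (pdy u (x, y)) y := by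
  have h := hasDerivAt_snd_slice (hu.differentiableAt hp)
  rwa [← h.deriv] at h

lemma integrableOn_SQo {g : ℝ × ℝ → ℝ} (hg : ContinuousOn g SQ) : IntegrableOn g SQo :=
  (hg.integrableOn_compact (isCompact_Icc.prod isCompact_Icc)).mono_set
    (prod_mono Ioo_subset_Icc_self Ioo_subset_Icc_self)

lemma integral_SQo {g : ℝ × ℝ → ℝ} (hg : ContinuousOn g SQ) :
    ∫ p in SQo, g p = ∫ x in Ioo (0 : ℝ) 1, ∫ y in Ioo (0 : ℝ) 1, g (x, y) :=
  setIntegral_prod g (integrableOn_SQo hg)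

lemma integrableOn_integral_slice {g : ℝ × ℝ → ℝ} (hg : ContinuousOn g SQ) :
    IntegrableOn (fun x => ∫ y in Ioo (0 : ℝ) 1, g (x, y)) (Ioo (0 : ℝ) 1) := by
  have h := integrableOn_SQo hg
  rw [IntegrableOn, SQo, Measure.volume_eq_prod, ← Measure.prod_restrict] at h
  exact h.integral_prod_left

lemma continuousOn_slice {g : ℝ × ℝ → ℝ} (hg : ContinuousOn g SQ) {x : ℝ}
    (hx : x ∈ Icc (0 : ℝ) 1) : ContinuousOn (fun y => g (x, y)) (Icc 0 1) :=
  hg.comp (by fun_prop) fun _ hy => ⟨hx, hy⟩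

lemma intervalIntegral_zero_one_eq (f : ℝ → ℝ) :
    ∫ t in (0 : ℝ)..1, f t = ∫ t in Ioo (0 : ℝ) 1, f t := by
  rw [intervalIntegral.integral_of_le zero_le_one, integral_Ioc_eq_integral_Ioo]

lemma integrableOn_trace {u : ℝ × ℝ → ℝ} (hu : ContinuousOn u SQ) {y : ℝ}
    (hy : y ∈ Icc (0 : ℝ) 1) (U : ℝ) :
    IntegrableOn (fun x => (u (x, y) - U) ^ 2) (Ioo 0 1) := by
  have hc : ContinuousOn (fun x => u (x, y)) (Icc 0 1) :=
    hu.comp (by fun_prop) fun _ hx => ⟨hx, hy⟩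
  exact (((hc.sub continuousOn_const).pow 2).integrableOn_Icc).mono_set Ioo_subset_Icc_self

lemma integral_slice_sq_le {u : ℝ × ℝ → ℝ} (hu : C1Nbhd u) {x : ℝ} (hx : x ∈ Icc (0 : ℝ) 1)
    (U : ℝ) :
    (∫ y in Ioo (0 : ℝ) 1, u (x, y) ^ 2) + 2 * U ^ 2 ≤
      10 * ((∫ y in Ioo (0 : ℝ) 1, pdy u (x, y) ^ 2)
        + (u (x, 0) - U) ^ 2 + (u (x, 1) - -U) ^ 2) := by
  have hint : IntegrableOn (fun y => u (x, y) ^ 2) (Ioo 0 1) :=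
    (((continuousOn_slice hu.continuousOn hx).pow 2).integrableOn_Icc).mono_set
      Ioo_subset_Icc_self
  have hbound : ∀ y ∈ Ioo (0 : ℝ) 1, u (x, y) ^ 2 ≤
      10 * ((∫ y in Ioo (0 : ℝ) 1, pdy u (x, y) ^ 2)
        + (u (x, 0) - U) ^ 2 + (u (x, 1) - -U) ^ 2) - 2 * U ^ 2 := by
    intro y hy
    have h := sq_add_two_mul_sq_le (f := fun t => u (x, t)) (f' := fun t => pdy u (x, t))
      (fun t ht => hu.hasDerivAt_pdy ⟨hx, ht⟩) (continuousOn_slice hu.continuousOn_pdy hx)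
      (Ioo_subset_Icc_self hy) U
    rw [intervalIntegral_zero_one_eq] at h
    rw [sub_neg_eq_add]
    linarith
  have h := setIntegral_mono_on hint (integrableOn_const (by simp)) measurableSet_Ioo hbound
  rw [setIntegral_const] at h
  simp only [measureReal_def, Real.volume_Ioo, sub_zero, ENNReal.toReal_ofReal zero_le_one,
    one_smul] at h
  linarith

/-- Poincaré-type inequality adapted to the Complete Electrode Model on the unit square. -/
theorem cem_poincare_inequality :
    ∃ C > 0, ∀ u : ℝ × ℝ → ℝ, C1Nbhd u → ∀ U₀ U₁ : ℝ, U₀ + U₁ = 0 →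
      (∫ p in SQo, (u p) ^ 2) + U₀ ^ 2 + U₁ ^ 2 ≤
        C * ((∫ p in SQo, (pdx u p) ^ 2 + (pdy u p) ^ 2)
          + (∫ x in (0 : ℝ)..1, (u (x, 0) - U₀) ^ 2)
          + (∫ x in (0 : ℝ)..1, (u (x, 1) - U₁) ^ 2)) := by
  refine ⟨10, by norm_num, fun u hu U₀ U₁ hU => ?_⟩
  obtain rfl : U₁ = -U₀ := by linarith
  have hcu : ContinuousOn (fun p => u p ^ 2) SQ := hu.continuousOn.pow 2
  have hcy : ContinuousOn (fun p => pdy u p ^ 2) SQ := hu.continuousOn_pdy.pow 2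
  have hcx : ContinuousOn (fun p => pdx u p ^ 2) SQ := hu.continuousOn_pdx.pow 2
  have hgrad : ∫ p in SQo, pdy u p ^ 2 ≤ ∫ p in SQo, (pdx u p) ^ 2 + (pdy u p) ^ 2 :=
    integral_mono (integrableOn_SQo hcy) (integrableOn_SQo (hcx.add hcy))
      fun p => le_add_of_nonneg_left (sq_nonneg _)
  have hiu := integrableOn_integral_slice hcu
  have hiy := integrableOn_integral_slice hcy
  have hi₀ := integrableOn_trace hu.continuousOn (left_mem_Icc.2 zero_le_one) U₀
  have hi₁ := integrableOn_trace hu.continuousOn (right_mem_Icc.2 zero_le_one) (-U₀)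
  have hiy₀ : IntegrableOn
      (fun x => (∫ y in Ioo (0 : ℝ) 1, pdy u (x, y) ^ 2) + (u (x, 0) - U₀) ^ 2) (Ioo 0 1) :=
    hiy.add hi₀
  have hconst : IntegrableOn (fun _ : ℝ => 2 * U₀ ^ 2) (Ioo 0 1) := integrableOn_const (by simp)
  have h := setIntegral_mono_on (hiu.add hconst) ((hiy₀.add hi₁).const_mul 10)
    measurableSet_Ioo fun x hx => integral_slice_sq_le hu (Ioo_subset_Icc_self hx) U₀
  simp only [Pi.add_apply] at h
  rw [integral_add hiu hconst, integral_const_mul (10 : ℝ), integral_add hiy₀ hi₁,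
    integral_add hiy hi₀, ← integral_SQo hcu, ← integral_SQo hcy, setIntegral_const] at h
  simp only [measureReal_def, Real.volume_Ioo, sub_zero, ENNReal.toReal_ofReal zero_le_one,
    one_smul] at h
  rw [intervalIntegral_zero_one_eq, intervalIntegral_zero_one_eq]
  linarith [neg_sq U₀]
end
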